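/- Let k ≥ 1 and t > 0. Then for every 0 ≤ j ≤ k and every x ∈ (ℝ^n)^k one has Ψ_{k,t}(D_j x) = Ψ_{k−1,t}(x). Consequently multiplication by the cutoff Ψ_{k,t} is a chain map: for every function f : (ℝ^n)^{k+1} → ℝ, b(Ψ_{k,t}·f) = Ψ_{k−1,t}·(b f) as functions on (ℝ^n)^k. -/

import Mathlib

open scoped BigOperators
open MeasureTheory

noncomputable section

abbrev Euc (n : ℕ) : Type := EuclideanSpace ℝ (Fin n)

/-- The `i`-th simplicial face map `D_i : E^k → E^{k+1}`. -/
def face {n : ℕ} (k i : ℕ) (x : Fin k → Euc n) : Fin (k + 1) → Euc n :=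
  fun l =>
    if _hle : (l : ℕ) ≤ i then
      if h : (l : ℕ) < k then x ⟨l, h⟩
      else if h0 : 0 < k then x ⟨0, h0⟩ else 0
    else x ⟨(l : ℕ) - 1, by have hl := l.isLt; omega⟩

/-- The Hochschild boundary `b f = ∑ (-1)^i f ∘ D_i`. -/
def hb {n k : ℕ} (f : (Fin (k + 1) → Euc n) → ℝ) : (Fin k → Euc n) → ℝ :=
  fun x => ∑ i ∈ Finset.range (k + 1), (-1 : ℝ) ^ i * f (face k i x)

/-- Degeneracy `σ_i` omitting the `(i+1)`-st entry. -/
def degen {n : ℕ} (i : ℕ) {m : ℕ} (x : Fin (m + 1) → Euc n) : Fin m → Euc n :=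
  fun l =>
    if (l : ℕ) ≤ i then x ⟨l, by have hl := l.isLt; omega⟩
    else x ⟨(l : ℕ) + 1, by have hl := l.isLt; omega⟩

/-- Squared distance of cyclically consecutive entries. -/
def dsq {n m : ℕ} (x : Fin m → Euc n) (j : ℕ) : ℝ :=
  if hm : 0 < m then
    ‖x ⟨j % m, Nat.mod_lt _ hm⟩ - x ⟨(j + 1) % m, Nat.mod_lt _ hm⟩‖ ^ 2
  else 0

/-- Cutoff `Ψ` with `i` factors on `E^m`. -/
def Psi {n : ℕ} (ρ : ℝ → ℝ) (i : ℕ) (t : ℝ) {m : ℕ} (x : Fin m → Euc n) : ℝ :=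
  ∏ j ∈ Finset.range i, ρ (dsq x j / t)

/-- `η_{m,i,t} g = Ψ_{m+1,i,t} · (g ∘ σ_{i-1})`. -/
def eta {n : ℕ} (ρ : ℝ → ℝ) (i : ℕ) (t : ℝ) {m : ℕ} (g : (Fin m → Euc n) → ℝ) :
    (Fin (m + 1) → Euc n) → ℝ :=
  fun x => Psi ρ i t x * g (degen (i - 1) x)

/-- `H_{m,t} = ∑_{i=1}^{m+1} (-1)^{i+1} η_{m,i,t}`. -/
def Hmap {n : ℕ} (ρ : ℝ → ℝ) (t : ℝ) {m : ℕ} (g : (Fin m → Euc n) → ℝ) :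
    (Fin (m + 1) → Euc n) → ℝ :=
  fun x => ∑ i ∈ Finset.Icc 1 m, (-1 : ℝ) ^ (i + 1) * eta ρ i t g x

/-- `K_{m,t} g = ∫_t^1 H_{m,s/2}(∂_s Ψ_{m,s} · g) ds`. -/
def Kmap {n : ℕ} (ρ : ℝ → ℝ) (t : ℝ) {m : ℕ} (g : (Fin m → Euc n) → ℝ) :
    (Fin (m + 1) → Euc n) → ℝ :=
  fun x => ∫ s in t..(1 : ℝ), Hmap ρ (s / 2) (fun y => deriv (fun u => Psi ρ m u y) s * g y) x

/-- Standard basis vector in the `j`-th block, `l`-th coordinate. -/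
def blockVec (n m j : ℕ) (l : Fin n) : Fin m → Euc n :=
  fun j' => if (j' : ℕ) = j then EuclideanSpace.single l 1 else 0

/-- Iterated partial derivative `∂^α_j`. -/
def mpderiv {n m : ℕ} (j : ℕ) (α : Fin n → ℕ) (g : (Fin m → Euc n) → ℝ) :
    (Fin m → Euc n) → ℝ :=
  (List.finRange n).foldr
    (fun l gg => (fun h (x : Fin m → Euc n) => fderiv ℝ h x (blockVec n m j l))^[α l] gg) g


theorem face_eq_mod_of_le {n k i : ℕ} (hk : 0 < k) (x : Fin k → Euc n) (l : Fin (k + 1))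
    (h : (l : ℕ) ≤ i) : face k i x l = x ⟨l % k, Nat.mod_lt _ hk⟩ := by
  rcases Nat.lt_or_ge l k with hl | hl
  · simp [face, h, hl, Nat.mod_eq_of_lt hl]
  · have hlk : (l : ℕ) = k := by omega
    simp only [face, dif_pos h, dif_neg (not_lt.mpr hl), dif_pos hk]
    congr 2
    rw [hlk, Nat.mod_self]

theorem face_eq_pred_of_lt {n k i : ℕ} (x : Fin k → Euc n) (l : Fin (k + 1))
    (h : i < (l : ℕ)) : face k i x l = x ⟨(l : ℕ) - 1, by omega⟩ := by
  simp [face, not_le.mpr h]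

theorem dsq_face_self {n k j : ℕ} (hk : 0 < k) (hj : j ≤ k) (x : Fin k → Euc n) :
    dsq (face k j x) j = 0 := by
  have hmod : j % (k + 1) = j := Nat.mod_eq_of_lt (by omega)
  rw [dsq, dif_pos k.succ_pos, face_eq_mod_of_le hk _ _ (by simp [hmod])]
  rcases hj.lt_or_eq with h | rfl
  · have hmod' : (j + 1) % (k + 1) = j + 1 := Nat.mod_eq_of_lt (by omega)
    rw [face_eq_pred_of_lt _ _ (by simp [hmod'])]
    simp [hmod, hmod', Nat.mod_eq_of_lt h]
  · rw [face_eq_mod_of_le hk _ _ (by simp)]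
    simp [hmod]

theorem dsq_face_of_lt {n k j i : ℕ} (hj : j ≤ k) (hi : i < j) (x : Fin k → Euc n) :
    dsq (face k j x) i = dsq x i := by
  have hk : 0 < k := by omega
  have hmod : i % (k + 1) = i := Nat.mod_eq_of_lt (by omega)
  have hmod' : (i + 1) % (k + 1) = i + 1 := Nat.mod_eq_of_lt (by omega)
  rw [dsq, dif_pos k.succ_pos, face_eq_mod_of_le hk _ _ (by simp only [hmod]; omega),
    face_eq_mod_of_le hk _ _ (by simp only [hmod']; omega), dsq, dif_pos hk]
  simp only [hmod, hmod']

theorem dsq_face_succ {n k j i : ℕ} (hj : j ≤ i) (hi : i < k) (x : Fin k → Euc n) :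
    dsq (face k j x) (i + 1) = dsq x i := by
  have hk : 0 < k := by omega
  have hmod : (i + 1) % (k + 1) = i + 1 := Nat.mod_eq_of_lt (by omega)
  rw [dsq, dif_pos k.succ_pos, face_eq_pred_of_lt _ _ (by simp only [hmod]; omega),
    dsq, dif_pos hk]
  rcases (Nat.succ_le_of_lt hi).lt_or_eq with h | h
  · have hmod' : (i + 1 + 1) % (k + 1) = i + 1 + 1 := Nat.mod_eq_of_lt (by omega)
    rw [face_eq_pred_of_lt _ _ (by simp only [hmod']; omega)]
    simp [hmod, hmod', Nat.mod_eq_of_lt hi, Nat.mod_eq_of_lt h]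
  · subst h
    rw [face_eq_mod_of_le hk _ _ (by simp)]
    simp [Nat.mod_eq_of_lt hi]

theorem Psi_face {n k j : ℕ} {ρ : ℝ → ℝ} (hρ : ρ 0 = 1) (hk : 0 < k) (hj : j ≤ k) (t : ℝ)
    (x : Fin k → Euc n) : Psi ρ (k + 1) t (face k j x) = Psi ρ k t x := by
  rw [Psi, Psi, Finset.prod_range, Finset.prod_range,
    Fin.prod_univ_succAbove _ (⟨j, Nat.lt_succ_of_le hj⟩ : Fin (k + 1)),
    dsq_face_self hk hj, zero_div, hρ, one_mul]
  refine Finset.prod_congr rfl fun i _ => ?_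
  rcases Nat.lt_or_ge i j with h | h
  · rw [Fin.succAbove_of_castSucc_lt ⟨j, _⟩ i (Fin.lt_def.mpr h), Fin.val_castSucc,
      dsq_face_of_lt hj h]
  · rw [Fin.succAbove_of_le_castSucc ⟨j, _⟩ i (Fin.le_def.mpr h), Fin.val_succ,
      dsq_face_succ h i.isLt]

theorem stmt8 {n : ℕ} (hn : 1 ≤ n)
    (ρ : ℝ → ℝ) (hρsmooth : ContDiff ℝ (⊤ : ℕ∞) ρ)
    (hρ0 : ∀ r : ℝ, 0 ≤ ρ r) (hρ1 : ∀ r : ℝ, ρ r ≤ 1)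
    (hρone : ∀ r : ℝ, r ≤ 1 / 3 → ρ r = 1) (hρzero : ∀ r : ℝ, 1 / 2 < r → ρ r = 0)
    {k : ℕ} (hk : 1 ≤ k) (t : ℝ) (ht : 0 < t) :
    (∀ j ≤ k, ∀ x : Fin k → Euc n, Psi ρ (k + 1) t (face k j x) = Psi ρ k t x) ∧
      ∀ (f : (Fin (k + 1) → Euc n) → ℝ) (x : Fin k → Euc n),
        hb (fun y => Psi ρ (k + 1) t y * f y) x = Psi ρ k t x * hb f x := by
  have hface := fun j (hj : j ≤ k) (x : Fin k → Euc n) =>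
    Psi_face (hρone 0 (by norm_num)) hk hj t x
  refine ⟨hface, fun f x => ?_⟩
  simp only [hb, Finset.mul_sum]
  refine Finset.sum_congr rfl fun i hi => ?_
  rw [hface i (Nat.lt_succ_iff.mp (Finset.mem_range.mp hi))]
  ring
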